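/- Let T_2 denote the family of partial 2-trees. Every minimal (0,3)-universal bound of T_2 has at least 14 vertices, and every minimal (1,1)-universal bound of T_2 has at least 14 vertices. -/

import Mathlib

open SimpleGraph

/-- The involution pairing the label of an arc with the label of the corresponding
reverse arc: for `1 ≤ k ≤ 2n`, the labels `2i` (arc of type `i`) and `2i-1`
(reverse arc of type `i`) are swapped; edge labels `2n+1, …, 2n+m` are fixed. -/
def conjLab (n k : ℕ) : ℕ :=
  if k ≤ 2 * n then (if k % 2 = 0 then k - 1 else k + 1) else k

/-- An `(n,m)`-graph: a simple underlying graph together with a labelling of each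
ordered pair of adjacent vertices by a number in `{1, …, 2n+m}` (`lab u v = α`
means that `v` is an `α`-neighbor of `u`), compatible with reversal. -/
structure NMGraph (n m : ℕ) (V : Type) where
  und : SimpleGraph V
  lab : V → V → ℕ
  lab_mem : ∀ u v, und.Adj u v → 1 ≤ lab u v ∧ lab u v ≤ 2 * n + m
  lab_conj : ∀ u v, und.Adj u v → lab v u = conjLab n (lab u v)

/-- `N^α(u)`, the set of `α`-neighbors of `u`. -/
def NMGraph.nbr {n m : ℕ} {V : Type} (G : NMGraph n m V) (α : ℕ) (u : V) : Set V :=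
  {v | G.und.Adj u v ∧ G.lab u v = α}

/-- `G → H`: existence of a homomorphism of `(n,m)`-graphs, i.e. a vertex map
preserving adjacency together with the type (and direction) of every arc/edge. -/
def NMGraph.HomTo {n m : ℕ} {V W : Type} (G : NMGraph n m V) (H : NMGraph n m W) : Prop :=
  ∃ f : V → W, ∀ u v, G.und.Adj u v →
    H.und.Adj (f u) (f v) ∧ H.lab (f u) (f v) = G.lab u v

/-- The `(n,m)`-chromatic number of an `(n,m)`-graph: the least number of vertices
of a target of a homomorphism. -/
noncomputable def nmChrom (n m : ℕ) {V : Type} (G : NMGraph n m V) : ℕ :=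
  sInf {t | ∃ H : NMGraph n m (Fin t), G.HomTo H}

/-- The 2-tree extension: add a new vertex adjacent to both endpoints of the edge `uv`. -/
def addVertex {N : ℕ} (G : SimpleGraph (Fin N)) (u v : Fin N) : SimpleGraph (Fin (N + 1)) :=
  SimpleGraph.fromRel (fun a b =>
    (∃ a' b', a = Fin.castSucc a' ∧ b = Fin.castSucc b' ∧ G.Adj a' b') ∨
    (a = Fin.last N ∧ (b = Fin.castSucc u ∨ b = Fin.castSucc v)))

/-- 2-trees: `K₂` is a 2-tree, and adding a new vertex adjacent to the two endpoints
of an existing edge of a 2-tree yields a 2-tree. -/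
inductive Is2Tree : (N : ℕ) → SimpleGraph (Fin N) → Prop
  | base : Is2Tree 2 ⊤
  | extend {N : ℕ} {G : SimpleGraph (Fin N)} (u v : Fin N) (huv : G.Adj u v)
      (h : Is2Tree N G) : Is2Tree (N + 1) (addVertex G u v)

/-- A partial 2-tree: a graph isomorphic to a subgraph of some 2-tree. -/
def IsPartial2Tree {V : Type} (G : SimpleGraph V) : Prop :=
  ∃ (N : ℕ) (T : SimpleGraph (Fin N)) (f : G →g T), Is2Tree N T ∧ Function.Injective f

/-- The subgraph of an `(n,m)`-graph `T` determined by a vertex set `s` and a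
spanning collection of edges `H ≤ T.und`, keeping the inherited labels. -/
def NMGraph.restrict {n m : ℕ} {W : Type} (T : NMGraph n m W) (s : Set W)
    (H : SimpleGraph W) (hle : H ≤ T.und) : NMGraph n m {x : W // x ∈ s} where
  und := SimpleGraph.comap Subtype.val H
  lab := fun u v => T.lab u.1 v.1
  lab_mem := fun u v h => T.lab_mem u.1 v.1 (hle h)
  lab_conj := fun u v h => T.lab_conj u.1 v.1 (hle h)

/-- `T` is an `(n,m)`-universal bound of the family `T₂` of partial 2-trees. -/
def IsUnivBoundT2 (n m : ℕ) {W : Type} (T : NMGraph n m W) : Prop :=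
  ∀ (N : ℕ) (G : NMGraph n m (Fin N)), IsPartial2Tree G.und → G.HomTo T

/-- `T` is a minimal `(n,m)`-universal bound of `T₂`: it is a universal bound and
no proper subgraph of `T` is one. -/
def IsMinUnivBoundT2 (n m : ℕ) {W : Type} (T : NMGraph n m W) : Prop :=
  IsUnivBoundT2 n m T ∧
  ∀ (s : Set W) (H : SimpleGraph W) (hle : H ≤ T.und),
    (s ≠ Set.univ ∨ H ≠ T.und) → ¬ IsUnivBoundT2 n m (T.restrict s H hle)

lemma conjLab_conjLab (n : ℕ) {k : ℕ} (hk : 1 ≤ k) : conjLab n (conjLab n k) = k := by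
  unfold conjLab
  split_ifs <;> omega

lemma conjLab_mem {n m k : ℕ} (h₁ : 1 ≤ k) (h₂ : k ≤ 2 * n + m) :
    1 ≤ conjLab n k ∧ conjLab n k ≤ 2 * n + m := by
  unfold conjLab
  split_ifs <;> omega

/-- Add to `G` a new vertex that is an `α`-neighbor of `a` and a `β`-neighbor of `b`. -/
def NMGraph.cone {n m : ℕ} {V : Type} [DecidableEq V] (G : NMGraph n m V) (a b : V)
    {α β : ℕ} (hα : 1 ≤ α ∧ α ≤ 2 * n + m) (hβ : 1 ≤ β ∧ β ≤ 2 * n + m) :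
    NMGraph n m (Option V) where
  und :=
    { Adj := fun x y => match x, y with
        | some u, some v => G.und.Adj u v
        | some u, none => u = a ∨ u = b
        | none, some v => v = a ∨ v = b
        | none, none => False
      symm := ⟨by
        rintro (_ | u) (_ | v) h
        exacts [h, h, h, SimpleGraph.Adj.symm (G := G.und) h]⟩
      loopless := ⟨by
        rintro (_ | u) h
        exacts [h, G.und.loopless.irrefl u h]⟩ }
  lab := fun x y => match x, y with
    | some u, some v => G.lab u v
    | some u, none => if u = a then α else β
    | none, some v => conjLab n (if v = a then α else β)
    | none, none => 0
  lab_mem := by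
    have key : ∀ u : V, 1 ≤ (if u = a then α else β) ∧ (if u = a then α else β) ≤ 2 * n + m :=
      fun u => by split_ifs <;> assumption
    rintro (_ | u) (_ | v) h
    exacts [h.elim, conjLab_mem (key v).1 (key v).2, key u, G.lab_mem u v h]
  lab_conj := by
    have key : ∀ u : V, 1 ≤ (if u = a then α else β) :=
      fun u => by split_ifs <;> omega
    rintro (_ | u) (_ | v) h
    exacts [h.elim, (conjLab_conjLab n (key v)).symm, rfl, G.lab_conj u v h]

lemma NMGraph.isPartial2Tree_cone {n m : ℕ} {V : Type} [DecidableEq V] {G : NMGraph n m V}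
    (hG : IsPartial2Tree G.und) {a b : V} (hab : G.und.Adj a b) {α β : ℕ}
    (hα : 1 ≤ α ∧ α ≤ 2 * n + m) (hβ : 1 ≤ β ∧ β ≤ 2 * n + m) :
    IsPartial2Tree (G.cone a b hα hβ).und := by
  obtain ⟨N, T, f, hT, hf⟩ := hG
  refine ⟨N + 1, addVertex T (f a) (f b),
    ⟨fun x => x.elim (Fin.last N) fun v => (f v).castSucc, ?_⟩,
    .extend _ _ (f.map_adj hab) hT, ?_⟩
  · rintro (_ | u) (_ | v) h
    · exact h.elim
    · refine (SimpleGraph.fromRel_adj _ _ _).2 ⟨(Fin.castSucc_lt_last _).ne', .inl (.inr ⟨rfl, ?_⟩)⟩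
      rcases h with rfl | rfl <;> simp
    · refine (SimpleGraph.fromRel_adj _ _ _).2 ⟨(Fin.castSucc_lt_last _).ne, .inr (.inr ⟨rfl, ?_⟩)⟩
      rcases h with rfl | rfl <;> simp
    · have h' := f.map_adj (show G.und.Adj u v from h)
      exact (SimpleGraph.fromRel_adj _ _ _).2
        ⟨(Fin.castSucc_injective N).ne h'.ne, .inl (.inl ⟨_, _, rfl, rfl, h'⟩)⟩
  · rintro (_ | u) (_ | v) h
    · rfl
    · exact absurd h (Fin.castSucc_lt_last _).ne'
    · exact absurd h (Fin.castSucc_lt_last _).ne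
    · exact congrArg some (hf (Fin.castSucc_injective N h))

lemma IsUnivBoundT2.homTo {n m : ℕ} {W : Type} {T : NMGraph n m W} (hT : IsUnivBoundT2 n m T)
    {V : Type} [Fintype V] (G : NMGraph n m V) (hG : IsPartial2Tree G.und) : G.HomTo T := by
  let e := (Fintype.equivFin V).symm
  obtain ⟨N, T', f, hT', hf⟩ := hG
  obtain ⟨g, hg⟩ := hT _
    { und := G.und.comap e
      lab := fun u v => G.lab (e u) (e v)
      lab_mem := fun u v h => G.lab_mem _ _ h
      lab_conj := fun u v h => G.lab_conj _ _ h }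
    ⟨N, T', f.comp (SimpleGraph.Hom.comap e G.und), hT', hf.comp e.injective⟩
  refine ⟨fun v => g (e.symm v), fun u v h => ?_⟩
  simpa using hg (e.symm u) (e.symm v) (by simpa using h)

/-- A partial 2-tree extends to one in which every edge of a given list has a common neighbor
of prescribed types. -/
lemma NMGraph.exists_extension {n m : ℕ} {V : Type} [Fintype V] (G : NMGraph n m V)
    (hG : IsPartial2Tree G.und) {α β : ℕ}
    (hα : 1 ≤ α ∧ α ≤ 2 * n + m) (hβ : 1 ≤ β ∧ β ≤ 2 * n + m)
    (L : List (V × V)) :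
    ∃ (V' : Type) (_ : Fintype V') (G' : NMGraph n m V') (i : V → V'),
      IsPartial2Tree G'.und ∧
      (∀ u v, G.und.Adj u v → G'.und.Adj (i u) (i v) ∧ G'.lab (i u) (i v) = G.lab u v) ∧
      ∀ p ∈ L, G.und.Adj p.1 p.2 →
        ∃ c, c ∈ G'.nbr α (i p.1) ∧ c ∈ G'.nbr β (i p.2) := by
  classical
  induction L with
  | nil => exact ⟨V, inferInstance, G, id, hG, fun u v h => ⟨h, rfl⟩, by simp⟩
  | cons p L ih =>
    obtain ⟨V', _, G', i, hG', hi, hL⟩ := ih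
    by_cases hp : G.und.Adj p.1 p.2
    · have hp' := (hi _ _ hp).1
      refine ⟨Option V', inferInstance, G'.cone (i p.1) (i p.2) hα hβ, fun v => some (i v),
        isPartial2Tree_cone hG' hp' hα hβ, hi, ?_⟩
      intro q hq hadj
      rcases List.mem_cons.1 hq with rfl | hq
      · exact ⟨none, ⟨.inl rfl, if_pos rfl⟩, ⟨.inr rfl, if_neg hp'.ne'⟩⟩
      · obtain ⟨c, h₁, h₂⟩ := hL q hq hadj
        exact ⟨some c, h₁, h₂⟩
    · refine ⟨V', inferInstance, G', i, hG', hi, fun q hq hadj => ?_⟩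
      rcases List.mem_cons.1 hq with rfl | hq
      · exact absurd hadj hp
      · exact hL q hq hadj

/-- In a minimal universal bound, the endpoints of any edge have common neighbors of all pairs
of types. -/
lemma IsMinUnivBoundT2.exists_common_nbr {n m : ℕ} {W : Type} {T : NMGraph n m W}
    (hT : IsMinUnivBoundT2 n m T) {x y : W} (hxy : T.und.Adj x y) {α β : ℕ}
    (hα : 1 ≤ α ∧ α ≤ 2 * n + m) (hβ : 1 ≤ β ∧ β ≤ 2 * n + m) :
    ∃ w, w ∈ T.nbr α x ∧ w ∈ T.nbr β y := by
  by_contra hno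
  refine hT.2 Set.univ (T.und.deleteEdges {s(x, y)}) (SimpleGraph.deleteEdges_le _)
    (.inr fun h => ?_) ?_
  · rw [← h] at hxy
    simp at hxy
  · intro N G hG
    obtain ⟨V', _, G', i, hG', hi, hL⟩ :=
      G.exists_extension hG hα hβ (Finset.univ : Finset (Fin N × Fin N)).toList
    obtain ⟨g, hg⟩ := hT.1.homTo G' hG'
    have avoid : ∀ u v, G.und.Adj u v → ¬ (g (i u) = x ∧ g (i v) = y) := by
      rintro u v h ⟨rfl, rfl⟩
      obtain ⟨c, ⟨h₁, h₂⟩, h₃, h₄⟩ := hL (u, v) (by simp) h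
      exact hno ⟨g c, ⟨(hg _ _ h₁).1, (hg _ _ h₁).2.trans h₂⟩,
        ⟨(hg _ _ h₃).1, (hg _ _ h₃).2.trans h₄⟩⟩
    refine ⟨fun u => ⟨g (i u), trivial⟩, fun u v h => ?_⟩
    obtain ⟨h₁, h₂⟩ := hi u v h
    refine ⟨?_, (hg _ _ h₁).2.trans h₂⟩
    refine SimpleGraph.deleteEdges_adj.2 ⟨(hg _ _ h₁).1, fun h' => ?_⟩
    rcases Sym2.eq_iff.1 h' with h' | h'
    · exact avoid u v h h'
    · exact avoid v u h.symm h'.symm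

lemma IsUnivBoundT2.exists_adj {n m : ℕ} {W : Type} {T : NMGraph n m W}
    (hT : IsUnivBoundT2 n m T) (hnm : 1 ≤ m) : ∃ u v, T.und.Adj u v := by
  obtain ⟨f, hf⟩ := hT 2
    { und := ⊤
      lab := fun _ _ => 2 * n + 1
      lab_mem := fun _ _ _ => by omega
      lab_conj := fun _ _ _ => by simp [conjLab] }
    ⟨2, ⊤, .id, .base, Function.injective_id⟩
  exact ⟨f 0, f 1, (hf 0 1 (by simp)).1⟩

section Counting

variable {n m : ℕ} {W : Type} {T : NMGraph n m W}

open Classical in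
/-- If `v` is an `α`-neighbor of `u`, then `v` together with three common neighbors of `u` and `v`
form four `α`-neighbors of `u`. -/
lemma IsMinUnivBoundT2.exists_four_nbrs (hT : IsMinUnivBoundT2 n m T) (h3 : 2 * n + m = 3)
    {u v : W} {α : ℕ} (hv : v ∈ T.nbr α u) :
    ∃ s : Finset W, s.card = 4 ∧ (∀ w ∈ s, w ∈ T.nbr α u) ∧
      ∀ w ∈ s, ∀ w' ∈ s, ∀ γ, w ∈ T.nbr γ v → w' ∈ T.nbr γ v → w = w' := by
  have hα := hv.2 ▸ T.lab_mem u v hv.1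
  obtain ⟨a, ha, ha'⟩ := hT.exists_common_nbr hv.1 hα (β := 1) (by omega)
  obtain ⟨b, hb, hb'⟩ := hT.exists_common_nbr hv.1 hα (β := 2) (by omega)
  obtain ⟨c, hc, hc'⟩ := hT.exists_common_nbr hv.1 hα (β := 3) (by omega)
  have hva := ha'.1.ne
  have hvb := hb'.1.ne
  have hvc := hc'.1.ne
  have la := ha'.2
  have lb := hb'.2
  have lc := hc'.2
  have hab : a ≠ b := by rintro rfl; omega
  have hac : a ≠ c := by rintro rfl; omega
  have hbc : b ≠ c := by rintro rfl; omega
  refine ⟨{v, a, b, c}, by simp [*], by simp [*], ?_⟩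
  intro w hw w' hw' γ h h'
  have h₁ := h.1.ne
  have h₂ := h'.1.ne
  have h₃ := h.2
  have h₄ := h'.2
  simp only [Finset.mem_insert, Finset.mem_singleton] at hw hw'
  rcases hw with rfl | rfl | rfl | rfl <;> rcases hw' with rfl | rfl | rfl | rfl <;>
    first | rfl | omega | exact absurd rfl h₁ | exact absurd rfl h₂

variable [Fintype W]

open Classical in
lemma NMGraph.card_nbr_le_degree (T : NMGraph n m W) (u : W) :
    (T.nbr 1 u).toFinset.card + (T.nbr 2 u).toFinset.card + (T.nbr 3 u).toFinset.card
      ≤ T.und.degree u := by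
  have disj : ∀ {α β : ℕ}, α ≠ β → Disjoint (T.nbr α u).toFinset (T.nbr β u).toFinset := by
    intro α β hne
    rw [Finset.disjoint_left]
    intro w hw hw'
    rw [Set.mem_toFinset] at hw hw'
    exact hne (hw.2.symm.trans hw'.2)
  have sub : ∀ α, (T.nbr α u).toFinset ⊆ T.und.neighborFinset u := by
    intro α w hw
    rw [Set.mem_toFinset] at hw
    simpa using hw.1
  rw [← Finset.card_union_of_disjoint (disj (by decide)), ← Finset.card_union_of_disjoint
    (Finset.disjoint_union_left.2 ⟨disj (by decide), disj (by decide)⟩)]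
  exact Finset.card_le_card (Finset.union_subset (Finset.union_subset (sub 1) (sub 2)) (sub 3))

open Classical in
lemma IsMinUnivBoundT2.four_le_card_nbr (hT : IsMinUnivBoundT2 n m T) (h3 : 2 * n + m = 3)
    {u v : W} (huv : T.und.Adj u v) {α : ℕ} (hα : 1 ≤ α ∧ α ≤ 3) :
    4 ≤ (T.nbr α u).toFinset.card := by
  obtain ⟨w, hw, -⟩ := hT.exists_common_nbr huv (h3 ▸ hα) (h3 ▸ hα)
  obtain ⟨s, hs, hsub, -⟩ := hT.exists_four_nbrs h3 hw
  rw [← hs]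
  exact Finset.card_le_card fun x hx => by simpa using hsub x hx

open Classical in
/-- If all neighborhoods of type `3` have four elements, every edge of type `3` lies in a unique
triangle of that type, so rotating triangles shows that the number of such (ordered) edges is
divisible by three. -/
lemma IsMinUnivBoundT2.three_dvd_card_edges (hT : IsMinUnivBoundT2 n m T) (h3 : 2 * n + m = 3)
    (hcard : ∀ u, (T.nbr 3 u).toFinset.card = 4) :
    3 ∣ Fintype.card (Σ u, T.nbr 3 u) := by
  have symm : ∀ {u v}, v ∈ T.nbr 3 u → u ∈ T.nbr 3 v := by
    rintro u v ⟨h, h'⟩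
    refine ⟨h.symm, ?_⟩
    rw [T.lab_conj u v h, h', conjLab, if_neg (by omega)]
  have uniq : ∀ {u v w w'}, v ∈ T.nbr 3 u → w ∈ T.nbr 3 u → w ∈ T.nbr 3 v → w' ∈ T.nbr 3 u →
      w' ∈ T.nbr 3 v → w = w' := by
    intro u v w w' hv hw hwv hw' hwv'
    obtain ⟨s, hs, hsub, hu⟩ := hT.exists_four_nbrs h3 hv
    have heq : s = (T.nbr 3 u).toFinset :=
      Finset.eq_of_subset_of_card_le (fun x hx => by simpa using hsub x hx)
        (by rw [hs, hcard])
    exact hu w (by simpa [heq] using hw) w' (by simpa [heq] using hw') 3 hwv hwv'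
  have ex : ∀ p : Σ u, T.nbr 3 u, ∃ w, w ∈ T.nbr 3 p.1 ∧ w ∈ T.nbr 3 p.2.1 := fun p =>
    hT.exists_common_nbr p.2.2.1 (by omega) (by omega)
  choose third h₁ h₂ using ex
  let rot : (Σ u, T.nbr 3 u) → Σ u, T.nbr 3 u := fun p => ⟨p.2.1, third p, h₂ p⟩
  have third_rot : ∀ p, third (rot p) = p.1 := fun p =>
    uniq (h₂ p) (h₁ (rot p)) (h₂ (rot p)) (symm p.2.2) (symm (h₁ p))
  have rot3 : ∀ p, rot (rot (rot p)) = p := by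
    intro p
    have e₁ : (rot (rot (rot p))).1 = p.1 := third_rot p
    have e₂ : (rot (rot (rot p))).2.1 = p.2.1 := third_rot (rot p)
    exact Sigma.subtype_ext e₁ e₂
  let f : Equiv.Perm (Σ u, T.nbr 3 u) := ⟨rot, fun p => rot (rot p), rot3, rot3⟩
  have : Fact (Nat.Prime 3) := ⟨Nat.prime_three⟩
  by_contra hdvd
  obtain ⟨p, hp⟩ := Equiv.Perm.exists_fixed_point_of_prime (p := 3) (n := 1) hdvd
    (σ := f) (Equiv.ext rot3)
  exact p.2.2.1.ne (congrArg Sigma.fst hp).symm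

lemma IsMinUnivBoundT2.fourteen_le_card (hT : IsMinUnivBoundT2 n m T) (h3 : 2 * n + m = 3) :
    14 ≤ Fintype.card W := by
  classical
  by_contra! hlt
  obtain ⟨u₀, v₀, h₀⟩ := hT.1.exists_adj (by omega)
  have small : ∀ {u v}, T.und.Adj u v →
      Fintype.card W = 13 ∧ T.und.degree u = 12 ∧ (T.nbr 3 u).toFinset.card = 4 := by
    intro u v h
    have h₁ := hT.four_le_card_nbr h3 h (α := 1) (by omega)
    have h₂ := hT.four_le_card_nbr h3 h (α := 2) (by omega)
    have h₃ := hT.four_le_card_nbr h3 h (α := 3) (by omega)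
    have := T.card_nbr_le_degree u
    have := T.und.degree_lt_card_verts u
    omega
  have full : T.und.neighborFinset u₀ = Finset.univ.erase u₀ := by
    refine Finset.eq_of_subset_of_card_le (fun w hw => ?_) ?_
    · simpa using (T.und.ne_of_adj (by simpa using hw)).symm
    · rw [Finset.card_erase_of_mem (Finset.mem_univ _), SimpleGraph.card_neighborFinset_eq_degree,
        Finset.card_univ, (small h₀).1, (small h₀).2.1]
  have adj : ∀ u, ∃ v, T.und.Adj u v := by
    intro u
    by_cases hu : u = u₀
    · exact ⟨v₀, hu ▸ h₀⟩
    · have : u ∈ T.und.neighborFinset u₀ := by simp [full, hu]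
      exact ⟨u₀, ((T.und.mem_neighborFinset _ _).1 this).symm⟩
  have hcard : ∀ u, (T.nbr 3 u).toFinset.card = 4 := fun u => (small (adj u).choose_spec).2.2
  have hdvd := hT.three_dvd_card_edges h3 hcard
  simp only [Fintype.card_sigma, ← Set.toFinset_card, hcard, Finset.sum_const, Finset.card_univ,
    (small h₀).1] at hdvd
  norm_num at hdvd

end Counting

/-- Every minimal `(0,3)`-universal bound of the partial 2-trees has at least 14
vertices, and every minimal `(1,1)`-universal bound of the partial 2-trees has at
least 14 vertices. -/
theorem minUnivBoundT2_ge_fourteen :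
    (∀ (W : Type) [Fintype W] (T : NMGraph 0 3 W),
        IsMinUnivBoundT2 0 3 T → 14 ≤ Fintype.card W) ∧
    (∀ (W : Type) [Fintype W] (T : NMGraph 1 1 W),
        IsMinUnivBoundT2 1 1 T → 14 ≤ Fintype.card W) := by
  exact ⟨fun W _ T hT => hT.fourteen_le_card rfl, fun W _ T hT => hT.fourteen_le_card rfl⟩
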